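/- (Energy estimate with frequency-localized second factor) Let s > 1/2 and R > 0. There exists a constant C(R) > 0 such that for all divergence-free Schwartz vector fields u, v : ℝ³ → ℝ³ with the Fourier transform of v supported in the ball {ξ ∈ ℝ³ : |ξ| ≤ R}, there exists a sequence (c_q)_{q ≥ −1} of nonnegative numbers with Σ_{q ≥ −1} c_q² ≤ 1 such that for every integer q ≥ −1, ‖Δ_q^v(u·∇v)‖_{L²(ℝ³)} ≤ C(R) c_q 2^{−qs} ‖u‖_{H^{0,s}} ‖v‖_{H^{0,s}}. -/

import Mathlib

/- Energy estimate with frequency-localized second factor (Lemma "EnergyCompact"). -/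

open MeasureTheory Real
open scoped FourierTransform ENNReal NNReal
noncomputable section

abbrev E3 := EuclideanSpace ℝ (Fin 3)

/-- anisotropic Sobolev norm `H^{σ₁,σ₂}(ℝ³)`, defined through the Fourier transform. -/
def anisoNorm (σ₁ σ₂ : ℝ) (f : E3 → ℂ) : ℝ :=
  (∫ ξ : E3, (1 + ((ξ 0)^2 + (ξ 1)^2)) ^ σ₁ * (1 + (ξ 2)^2) ^ σ₂ * ‖𝓕 f ξ‖^2) ^ (1/2 : ℝ)

/-- The standing assumptions on the dyadic cut-off function `ψ`:  smooth, even,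
equal to `1` on a neighborhood of `[-3/4, 3/4]` and supported in `[-4/3, 4/3]`. -/
structure VCutoff (ψ : ℝ → ℝ) : Prop where
  smooth : ContDiff ℝ (⊤ : ℕ∞) ψ
  even : ∀ x, ψ (-x) = ψ x
  one_near : ∀ᶠ x in nhdsSet (Set.Icc (-(3/4) : ℝ) (3/4)), ψ x = 1
  supp : ∀ x : ℝ, ψ x ≠ 0 → |x| ≤ 4/3

/-- `φ(z) = ψ(z/2) - ψ(z)`. -/
def phiV (ψ : ℝ → ℝ) (z : ℝ) : ℝ := ψ (z/2) - ψ z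

/-- vertical dyadic block `Δ_q^v` (for `q ≥ 0` given by `φ(|ξ₃|/2^q)`, for `q = -1` by `ψ(|ξ₃|)`). -/
def deltaV (ψ : ℝ → ℝ) (q : ℤ) (f : E3 → ℂ) : E3 → ℂ :=
  𝓕⁻ (fun ξ => ((if q = -1 then ψ |ξ 2| else phiV ψ (|ξ 2| / 2 ^ q) : ℝ) : ℂ) * 𝓕 f ξ)

/-- partial derivative `∂_j` of a real-valued function on `ℝ³`. -/
def pd (j : Fin 3) (f : E3 → ℝ) : E3 → ℝ :=
  fun x => fderiv ℝ f x (EuclideanSpace.single j 1)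

def toC (f : E3 → ℝ) : E3 → ℂ := fun x => (f x : ℂ)

/-- componentwise vertical dyadic block of a (complexified) vector field. -/
def deltaVF (ψ : ℝ → ℝ) (q : ℤ) (f : Fin 3 → E3 → ℂ) : Fin 3 → E3 → ℂ :=
  fun i => deltaV ψ q (f i)

/-- `L²(ℝ³)` inner product of vector fields. -/
def L2ipF (f g : Fin 3 → E3 → ℂ) : ℂ := ∫ x : E3, ∑ i, (starRingEnd ℂ) (f i x) * g i x

/-- convection term `u·∇v = Σ_j u^j ∂_j v`. -/
def convT (u v : Fin 3 → E3 → ℝ) : Fin 3 → E3 → ℝ :=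
  fun i x => ∑ j, u j x * pd j (v i) x

/-- divergence-free condition. -/
def DivFree (u : Fin 3 → E3 → ℝ) : Prop := ∀ x, ∑ j, pd j (u j) x = 0

/-- anisotropic norm of a vector field. -/
def anisoNormF (σ₁ σ₂ : ℝ) (u : Fin 3 → E3 → ℝ) : ℝ :=
  (∑ i, (anisoNorm σ₁ σ₂ (toC (u i)))^2) ^ (1/2 : ℝ)

/-- anisotropic norm of the horizontal gradient of a vector field. -/
def gradHNormF (s : ℝ) (u : Fin 3 → E3 → ℝ) : ℝ :=
  (∑ i, ((anisoNorm 0 s (toC (pd 0 (u i))))^2 + (anisoNorm 0 s (toC (pd 1 (u i))))^2)) ^ (1/2 : ℝ)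

/-- `L²(ℝ³)` norm of a (complex-valued) vector field. -/
def l2NormF (f : Fin 3 → E3 → ℂ) : ℝ := (∫ x : E3, ∑ i, ‖f i x‖^2) ^ (1/2 : ℝ)

open scoped SchwartzMap LineDeriv

theorem fourier_eq_convolution_of_eq_mul (f g h : 𝓢(E3, ℂ)) (hh : ∀ x, h x = f x * g x) (ξ : E3) :
    𝓕 h ξ = ∫ η, 𝓕 f (ξ - η) * 𝓕 g η := by
  let B := ContinuousLinearMap.mul ℂ ℂ
  have double (k : 𝓢(E3, ℂ)) (x : E3) : 𝓕 (𝓕 k) (-x) = k x := by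
    have : (𝓕⁻ (𝓕 k)) x = k x := by simp
    rw [← this, SchwartzMap.fourierInv_coe, Real.fourierInv_eq_fourier_neg]
    rfl
  have key : h = 𝓕⁻ (SchwartzMap.convolution B (𝓕 g) (𝓕 f)) := by
    ext x
    rw [SchwartzMap.fourierInv_coe, Real.fourierInv_eq_fourier_neg, ← SchwartzMap.fourier_coe,
      SchwartzMap.fourier_convolution, SchwartzMap.pairing_apply_apply, double, double, hh]
    simp [B, mul_comm]
  rw [key, FourierTransform.fourier_fourierInv_eq, SchwartzMap.convolution_apply]
  simp [convolution, B, mul_comm]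

theorem enorm_integral_mul_sq_le_of_support {a b : E3 → ℂ} (ha : Continuous a) (hb : Continuous b)
    {S : Set E3} (hbS : ∀ η, b η ≠ 0 → η ∈ S) (ξ : E3) :
    ‖∫ η, a (ξ - η) * b η‖ₑ ^ 2 ≤ (∫⁻ η in S, ‖a (ξ - η)‖ₑ ^ 2) * ∫⁻ η, ‖b η‖ₑ ^ 2 := by
  have hsupp : ∫ η, a (ξ - η) * b η = ∫ η in S, a (ξ - η) * b η := by
    refine (setIntegral_eq_integral_of_forall_compl_eq_zero fun η hη => ?_).symm
    rw [not_imp_comm.1 (hbS η) hη, mul_zero]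
  have hCS := ENNReal.lintegral_mul_le_Lp_mul_Lq (volume.restrict S) Real.HolderConjugate.two_two
    (f := fun η => ‖a (ξ - η)‖ₑ) (g := fun η => ‖b η‖ₑ)
    (by fun_prop) (by fun_prop)
  have hle : ‖∫ η, a (ξ - η) * b η‖ₑ ≤ ∫⁻ η in S, ‖a (ξ - η)‖ₑ * ‖b η‖ₑ := by
    rw [hsupp]
    simpa using enorm_integral_le_lintegral_enorm (μ := volume.restrict S)
      (fun η => a (ξ - η) * b η)
  have hroot (x : ℝ≥0∞) : (x ^ (1 / 2 : ℝ)) ^ 2 = x := by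
    rw [← ENNReal.rpow_natCast, ← ENNReal.rpow_mul]; norm_num
  calc ‖∫ η, a (ξ - η) * b η‖ₑ ^ 2
      ≤ ((∫⁻ η in S, ‖a (ξ - η)‖ₑ ^ (2 : ℝ)) ^ (1 / 2 : ℝ) *
          (∫⁻ η in S, ‖b η‖ₑ ^ (2 : ℝ)) ^ (1 / 2 : ℝ)) ^ 2 := by
        gcongr
        exact hle.trans hCS
    _ = (∫⁻ η in S, ‖a (ξ - η)‖ₑ ^ 2) * ∫⁻ η in S, ‖b η‖ₑ ^ 2 := by
        rw [mul_pow, hroot, hroot]; norm_num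
    _ ≤ _ := by
        gcongr
        exact Measure.restrict_le_self

theorem lintegral_weight_mul_convolution_sq_le {a b : E3 → ℂ} (ha : Continuous a)
    (hb : Continuous b) {S : Set E3} (hS : MeasurableSet S) (hbS : ∀ η, b η ≠ 0 → η ∈ S)
    {w : E3 → ℝ≥0∞} (hw : Measurable w) {A : ℝ≥0∞}
    (hwS : ∀ ξ, ∀ η ∈ S, w ξ ≤ A * w (ξ - η)) :
    ∫⁻ ξ, w ξ * ‖∫ η, a (ξ - η) * b η‖ₑ ^ 2 ≤
      A * volume S * (∫⁻ ξ, w ξ * ‖a ξ‖ₑ ^ 2) * ∫⁻ η, ‖b η‖ₑ ^ 2 := by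
  have ham := ha.measurable
  have hpt (ξ : E3) : w ξ * ‖∫ η, a (ξ - η) * b η‖ₑ ^ 2 ≤
      (∫⁻ η in S, A * (w (ξ - η) * ‖a (ξ - η)‖ₑ ^ 2)) * ∫⁻ η, ‖b η‖ₑ ^ 2 := by
    calc w ξ * ‖∫ η, a (ξ - η) * b η‖ₑ ^ 2
        ≤ w ξ * ((∫⁻ η in S, ‖a (ξ - η)‖ₑ ^ 2) * ∫⁻ η, ‖b η‖ₑ ^ 2) := by
          gcongr; exact enorm_integral_mul_sq_le_of_support ha hb hbS ξ
      _ = (∫⁻ η in S, w ξ * ‖a (ξ - η)‖ₑ ^ 2) * ∫⁻ η, ‖b η‖ₑ ^ 2 := by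
          rw [← mul_assoc, lintegral_const_mul _ (by fun_prop)]
      _ ≤ _ := by
          gcongr ?_ * _
          refine setLIntegral_mono' hS fun η hη => ?_
          rw [← mul_assoc]
          gcongr
          exact hwS ξ η hη
  have hmeas : Measurable fun ξ => w ξ * ‖a ξ‖ₑ ^ 2 := by fun_prop
  calc ∫⁻ ξ, w ξ * ‖∫ η, a (ξ - η) * b η‖ₑ ^ 2
      ≤ ∫⁻ ξ, (∫⁻ η in S, A * (w (ξ - η) * ‖a (ξ - η)‖ₑ ^ 2)) * ∫⁻ η, ‖b η‖ₑ ^ 2 :=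
        lintegral_mono hpt
    _ = (∫⁻ ξ, ∫⁻ η in S, A * (w (ξ - η) * ‖a (ξ - η)‖ₑ ^ 2)) * ∫⁻ η, ‖b η‖ₑ ^ 2 := by
        refine lintegral_mul_const _ ?_
        exact Measurable.lintegral_prod_right'
          (f := fun p : E3 × E3 => A * (w (p.1 - p.2) * ‖a (p.1 - p.2)‖ₑ ^ 2)) (by fun_prop)
    _ = (∫⁻ η in S, ∫⁻ ξ, A * (w (ξ - η) * ‖a (ξ - η)‖ₑ ^ 2)) * ∫⁻ η, ‖b η‖ₑ ^ 2 := by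
        rw [lintegral_lintegral_swap]
        exact Measurable.aemeasurable (by fun_prop)
    _ = _ := by
        congr 1
        have (η : E3) : ∫⁻ ξ, A * (w (ξ - η) * ‖a (ξ - η)‖ₑ ^ 2) =
            A * ∫⁻ ξ, w ξ * ‖a ξ‖ₑ ^ 2 := by
          rw [lintegral_sub_right_eq_self (fun ξ => A * (w ξ * ‖a ξ‖ₑ ^ 2)) η,
            lintegral_const_mul _ hmeas]
        simp_rw [this]
        rw [setLIntegral_const]
        ring

/-- The vertical Sobolev weight `(1 + ξ₃²)^s`. -/
def vWeight (s : ℝ) (ξ : E3) : ℝ := (1 + (ξ 2) ^ 2) ^ s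

theorem vWeight_pos (s : ℝ) (ξ : E3) : 0 < vWeight s ξ := by
  unfold vWeight; positivity

theorem one_le_vWeight {s : ℝ} (hs : 0 ≤ s) (ξ : E3) : 1 ≤ vWeight s ξ :=
  Real.one_le_rpow (by nlinarith [sq_nonneg (ξ 2)]) hs

theorem vWeight_half_sq (s : ℝ) (ξ : E3) : vWeight (s / 2) ξ ^ 2 = vWeight s ξ := by
  unfold vWeight
  rw [← Real.rpow_natCast, ← Real.rpow_mul (by positivity)]
  norm_num

theorem continuous_vWeight (s : ℝ) : Continuous (vWeight s) := by
  unfold vWeight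
  exact Continuous.rpow_const (by fun_prop) fun ξ => Or.inl (by positivity)

theorem hasTemperateGrowth_comp_coord {g : ℝ → ℝ} (hg : g.HasTemperateGrowth) (j : Fin 3) :
    (fun ξ : E3 => g (ξ j)).HasTemperateGrowth :=
  hg.comp (EuclideanSpace.proj j : E3 →L[ℝ] ℝ).hasTemperateGrowth

theorem hasTemperateGrowth_vWeight (s : ℝ) : (vWeight s).HasTemperateGrowth := by
  convert hasTemperateGrowth_comp_coord (Function.hasTemperateGrowth_one_add_norm_sq_rpow ℝ s) 2
    using 2 with ξ
  simp [vWeight]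

theorem vWeight_le_of_norm_le {s : ℝ} (hs : 0 ≤ s) {R : ℝ} (ξ : E3) {η : E3} (hη : ‖η‖ ≤ R) :
    vWeight s ξ ≤ (2 * (1 + R ^ 2)) ^ s * vWeight s (ξ - η) := by
  have h2 : |η 2| ≤ R := by simpa using (PiLp.norm_apply_le η 2).trans hη
  have h3 : (η 2) ^ 2 ≤ R ^ 2 := by
    rw [← sq_abs]; gcongr
  unfold vWeight
  rw [← Real.mul_rpow (by positivity) (by positivity)]
  refine Real.rpow_le_rpow (by positivity) ?_ hs
  simp only [PiLp.sub_apply]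
  nlinarith [sq_nonneg (ξ 2 - 2 * η 2), mul_nonneg (sq_nonneg R) (sq_nonneg (ξ 2 - η 2))]

theorem integrable_vWeight_mul_sq (s : ℝ) (f : 𝓢(E3, ℂ)) :
    Integrable fun ξ => vWeight s ξ * ‖f ξ‖ ^ 2 := by
  have h := (SchwartzMap.smulLeftCLM ℂ (vWeight (s / 2)) f).memLp 2
  refine (h.integrable_norm_pow two_ne_zero).congr (ae_of_all _ fun ξ => ?_)
  simp only [SchwartzMap.smulLeftCLM_apply_apply (hasTemperateGrowth_vWeight _), norm_smul,
    mul_pow, Real.norm_eq_abs, sq_abs, vWeight_half_sq]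

theorem ofReal_integral_vWeight_mul_sq (s : ℝ) (f : 𝓢(E3, ℂ)) :
    ENNReal.ofReal (∫ ξ, vWeight s ξ * ‖f ξ‖ ^ 2) =
      ∫⁻ ξ, ENNReal.ofReal (vWeight s ξ) * ‖f ξ‖ₑ ^ 2 := by
  rw [ofReal_integral_eq_lintegral_ofReal (integrable_vWeight_mul_sq s f)
    (ae_of_all _ fun ξ => mul_nonneg (vWeight_pos s ξ).le (by positivity))]
  refine lintegral_congr fun ξ => ?_
  rw [ENNReal.ofReal_mul (vWeight_pos s ξ).le, ENNReal.ofReal_pow (norm_nonneg _), ofReal_norm]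

theorem integral_vWeight_nonneg (s : ℝ) (f : 𝓢(E3, ℂ)) :
    0 ≤ ∫ ξ, vWeight s ξ * ‖f ξ‖ ^ 2 :=
  integral_nonneg fun ξ => mul_nonneg (vWeight_pos s ξ).le (by positivity)

theorem norm_fourier_lineDeriv_single_le (g : 𝓢(E3, ℂ)) (j : Fin 3) (ξ : E3) :
    ‖𝓕 (∂_{EuclideanSpace.single j (1 : ℝ)} g) ξ‖ ≤ 2 * π * ‖ξ‖ * ‖𝓕 g ξ‖ := by
  have htg : (fun ξ : E3 => inner ℝ ξ (EuclideanSpace.single j (1 : ℝ))).HasTemperateGrowth := by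
    fun_prop
  rw [SchwartzMap.fourier_lineDerivOp_eq, smul_apply,
    SchwartzMap.smulLeftCLM_apply_apply htg, norm_smul, norm_smul]
  have h : ‖inner ℝ ξ (EuclideanSpace.single j (1 : ℝ))‖ ≤ ‖ξ‖ := by
    simpa using norm_inner_le_norm (𝕜 := ℝ) ξ (EuclideanSpace.single j (1 : ℝ))
  have h2 : ‖(2 * π * Complex.I : ℂ)‖ = 2 * π := by simp [abs_of_pos Real.pi_pos]
  rw [h2, ← mul_assoc]
  gcongr

theorem integral_vWeight_fourier_mul_lineDeriv_le {s : ℝ} (hs : 0 ≤ s) {R : ℝ}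
    (f g h : 𝓢(E3, ℂ)) (j : Fin 3)
    (hh : ∀ x, h x = f x * (∂_{EuclideanSpace.single j (1 : ℝ)} g) x)
    (hg : ∀ ξ, 𝓕 g ξ ≠ 0 → ‖ξ‖ ≤ R) :
    ∫ ξ, vWeight s ξ * ‖𝓕 h ξ‖ ^ 2 ≤
      (2 * (1 + R ^ 2)) ^ s * volume.real (Metric.closedBall (0 : E3) R) * (2 * π * R) ^ 2 *
        (∫ ξ, vWeight s ξ * ‖𝓕 f ξ‖ ^ 2) * ∫ ξ, vWeight s ξ * ‖𝓕 g ξ‖ ^ 2 := by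
  set D := ∂_{EuclideanSpace.single j (1 : ℝ)} g
  have hD (ξ : E3) : ‖𝓕 D ξ‖ ≤ 2 * π * R * ‖𝓕 g ξ‖ := by
    refine (norm_fourier_lineDeriv_single_le g j ξ).trans ?_
    by_cases h0 : 𝓕 g ξ = 0
    · simp [h0]
    · have := hg ξ h0
      gcongr
  have hDS (ξ : E3) (h0 : 𝓕 D ξ ≠ 0) : ξ ∈ Metric.closedBall (0 : E3) R := by
    rw [mem_closedBall_zero_iff]
    refine hg ξ fun hz => h0 ?_
    simpa [hz] using hD ξ
  have hDint : ∫⁻ ξ, ‖𝓕 D ξ‖ₑ ^ 2 ≤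
      ENNReal.ofReal ((2 * π * R) ^ 2 * ∫ ξ, vWeight s ξ * ‖𝓕 g ξ‖ ^ 2) := by
    rw [ENNReal.ofReal_mul (by positivity), ofReal_integral_vWeight_mul_sq,
      ← lintegral_const_mul']
    · refine lintegral_mono fun ξ => ?_
      rw [← ofReal_norm, ← ofReal_norm, ← ENNReal.ofReal_pow (norm_nonneg _),
        ← ENNReal.ofReal_pow (norm_nonneg _), ← ENNReal.ofReal_mul (vWeight_pos s ξ).le,
        ← ENNReal.ofReal_mul (by positivity)]
      refine ENNReal.ofReal_le_ofReal ?_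
      calc ‖𝓕 D ξ‖ ^ 2 ≤ (2 * π * R * ‖𝓕 g ξ‖) ^ 2 := by gcongr; exact hD ξ
        _ = (2 * π * R) ^ 2 * (1 * ‖𝓕 g ξ‖ ^ 2) := by ring
        _ ≤ _ := by gcongr; exact one_le_vWeight hs ξ
    · exact ENNReal.ofReal_ne_top
  have main := lintegral_weight_mul_convolution_sq_le (𝓕 f).continuous (𝓕 D).continuous
    (S := Metric.closedBall (0 : E3) R) Metric.isClosed_closedBall.measurableSet hDS
    (w := fun ξ => ENNReal.ofReal (vWeight s ξ)) (A := ENNReal.ofReal ((2 * (1 + R ^ 2)) ^ s))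
    (continuous_vWeight s).measurable.ennreal_ofReal
    (fun ξ η hη => by
      rw [← ENNReal.ofReal_mul (by positivity)]
      exact ENNReal.ofReal_le_ofReal (vWeight_le_of_norm_le hs ξ (mem_closedBall_zero_iff.1 hη)))
  simp_rw [← fourier_eq_convolution_of_eq_mul f D h hh] at main
  rw [← ofReal_integral_vWeight_mul_sq, ← ofReal_integral_vWeight_mul_sq,
    ← ofReal_measureReal measure_closedBall_lt_top.ne] at main
  have hf := integral_vWeight_nonneg s (𝓕 f)
  have hg' := integral_vWeight_nonneg s (𝓕 g)
  refine (ENNReal.ofReal_le_ofReal_iff (by positivity)).1 ?_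
  refine (main.trans (mul_le_mul_right hDint _)).trans_eq ?_
  rw [← ENNReal.ofReal_mul (by positivity), ← ENNReal.ofReal_mul (by positivity),
    ← ENNReal.ofReal_mul (by positivity)]
  congr 1
  ring

/-- The Fourier symbol of `Δ_q^v`. -/
def dyadicSymbol (ψ : ℝ → ℝ) (q : ℤ) (ξ : E3) : ℝ :=
  if q = -1 then ψ |ξ 2| else phiV ψ (|ξ 2| / 2 ^ q)

namespace VCutoff

variable {ψ : ℝ → ℝ}

theorem apply_abs (hψ : VCutoff ψ) (x : ℝ) : ψ |x| = ψ x := by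
  rcases abs_choice x with h | h <;> simp [h, hψ.even]

theorem hasCompactSupport (hψ : VCutoff ψ) : HasCompactSupport ψ := by
  refine HasCompactSupport.of_support_subset_isCompact (isCompact_Icc (a := -(4/3 : ℝ)) (b := 4/3))
    fun x hx => ?_
  exact abs_le.1 (hψ.supp x hx)

theorem hasTemperateGrowth (hψ : VCutoff ψ) : ψ.HasTemperateGrowth :=
  hψ.hasCompactSupport.hasTemperateGrowth hψ.smooth

theorem hasTemperateGrowth_comp_mul (hψ : VCutoff ψ) (c : ℝ) :
    (fun x => ψ (c * x)).HasTemperateGrowth :=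
  hψ.hasTemperateGrowth.comp (g := ψ) (c • ContinuousLinearMap.id ℝ ℝ).hasTemperateGrowth

theorem hasTemperateGrowth_dyadicSymbol (hψ : VCutoff ψ) (q : ℤ) :
    (dyadicSymbol ψ q).HasTemperateGrowth := by
  by_cases hq : q = -1
  · convert hasTemperateGrowth_comp_coord hψ.hasTemperateGrowth 2 using 2 with ξ
    simp [dyadicSymbol, hq, hψ.apply_abs]
  · convert hasTemperateGrowth_comp_coord ((hψ.hasTemperateGrowth_comp_mul ((2 ^ q)⁻¹ / 2)).sub
      (hψ.hasTemperateGrowth_comp_mul (2 ^ q)⁻¹)) 2 using 2 with ξ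
    have h2 : (|ξ 2| / 2 ^ q : ℝ) = |(2 ^ q)⁻¹ * ξ 2| := by
      rw [abs_mul, abs_of_pos (by positivity : (0 : ℝ) < (2 ^ q)⁻¹), div_eq_inv_mul]
    have h3 : |(2 ^ q)⁻¹ * ξ 2| / 2 = |((2 : ℝ) ^ q)⁻¹ / 2 * ξ 2| := by
      rw [div_mul_eq_mul_div, abs_div]; norm_num
    simp only [dyadicSymbol, if_neg hq, phiV, h2, h3, hψ.apply_abs, Pi.sub_apply]

theorem exists_bound (hψ : VCutoff ψ) : ∃ B, 0 ≤ B ∧ ∀ x, |ψ x| ≤ B := by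
  obtain ⟨B, hB⟩ := hψ.hasCompactSupport.exists_bound_of_continuous hψ.smooth.continuous
  exact ⟨B, (norm_nonneg _).trans (hB 0), hB⟩

theorem three_quarters_le_of_phiV_ne_zero (hψ : VCutoff ψ) {z : ℝ} (hz : 0 ≤ z)
    (h : phiV ψ z ≠ 0) : 3 / 4 ≤ z := by
  by_contra! hlt
  have hone (x : ℝ) (hx : x ∈ Set.Icc (-(3/4) : ℝ) (3/4)) : ψ x = 1 :=
    hψ.one_near.self_of_nhdsSet x hx
  refine h ?_
  rw [phiV, hone _ ⟨by linarith, by linarith⟩, hone _ ⟨by linarith, by linarith⟩, sub_self]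

end VCutoff

theorem sum_range_ite_geom_le {s : ℝ} (hs : 0 < s) {y : ℝ} (N : ℕ) :
    ∑ k ∈ Finset.range N, (if (2 : ℝ) ^ k ≤ y then ((4 : ℝ) ^ s) ^ k else 0) ≤
      (4 : ℝ) ^ s / ((4 : ℝ) ^ s - 1) * (y ^ 2) ^ s := by
  set a := (4 : ℝ) ^ s
  have ha : 1 < a := Real.one_lt_rpow (by norm_num) hs
  have hpow (k : ℕ) (hk : (2 : ℝ) ^ k ≤ y) : a ^ k ≤ (y ^ 2) ^ s := by
    have : a ^ k = (((2 : ℝ) ^ k) ^ 2) ^ s := by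
      rw [← Real.rpow_natCast, ← Real.rpow_mul (by norm_num), mul_comm,
        Real.rpow_mul (by norm_num), Real.rpow_natCast, ← pow_mul, mul_comm k, pow_mul]
      norm_num
    rw [this]
    gcongr
  have ha1 : 0 < a - 1 := by linarith
  suffices h : ∑ k ∈ Finset.range N, (if (2 : ℝ) ^ k ≤ y then a ^ k else 0) ≤ a ^ N / (a - 1) ∧
      ∑ k ∈ Finset.range N, (if (2 : ℝ) ^ k ≤ y then a ^ k else 0) ≤
        a / (a - 1) * (y ^ 2) ^ s from h.2
  induction N with
  | zero =>
    simp only [Finset.range_zero, Finset.sum_empty]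
    constructor <;> positivity
  | succ N ih =>
    rw [Finset.sum_range_succ]
    split_ifs with hN
    · have h1 : a ^ N / (a - 1) + a ^ N = a ^ (N + 1) / (a - 1) := by
        field_simp
        ring
      have h2 : a ^ (N + 1) / (a - 1) = a / (a - 1) * a ^ N := by ring
      refine ⟨by linarith [ih.1], ?_⟩
      have h3 : a / (a - 1) * a ^ N ≤ a / (a - 1) * (y ^ 2) ^ s := by
        gcongr
        exact hpow N hN
      linarith [ih.1]
    · rw [add_zero]
      refine ⟨ih.1.trans ?_, ih.2⟩
      gcongr
      · exact ha.le
      · omega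

theorem VCutoff.exists_sum_dyadicSymbol_sq_le {ψ : ℝ → ℝ} (hψ : VCutoff ψ) {s : ℝ} (hs : 0 < s) :
    ∃ K > 0, ∀ (N : ℕ) (ξ : E3), ∑ n ∈ Finset.range N,
      ((2 : ℝ) ^ ((((n : ℤ) - 1 : ℤ) : ℝ) * s) * dyadicSymbol ψ ((n : ℤ) - 1) ξ) ^ 2 ≤
        K * vWeight s ξ := by
  obtain ⟨B, hB0, hB⟩ := hψ.exists_bound
  set a := (4 : ℝ) ^ s
  have ha : 1 < a := Real.one_lt_rpow (by norm_num) hs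
  have ha1 : 0 < a - 1 := by linarith
  refine ⟨(B ^ 2 + 1) + 4 * B ^ 2 * (a / (a - 1) * (16 / 9) ^ s), by positivity, fun N ξ => ?_⟩
  have hlow : ((2 : ℝ) ^ ((((0 : ℕ) : ℤ) - 1 : ℤ) * s) * dyadicSymbol ψ (((0 : ℕ) : ℤ) - 1) ξ) ^ 2
      ≤ B ^ 2 + 1 := by
    have h1 : (2 : ℝ) ^ (-s) ≤ 1 := Real.rpow_le_one_of_one_le_of_nonpos (by norm_num) (by linarith)
    have h2 : |(2 : ℝ) ^ (-s) * ψ (|ξ 2|)| ≤ B := by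
      rw [abs_mul, abs_of_pos (by positivity : (0 : ℝ) < 2 ^ (-s))]
      calc _ ≤ 1 * B := by gcongr; exact hB _
        _ = B := one_mul B
    have h3 := sq_le_sq' (by linarith [neg_le_of_abs_le h2]) (le_of_abs_le h2)
    simp only [dyadicSymbol]
    norm_num
    linarith
  have hhigh (k : ℕ) :
      ((2 : ℝ) ^ ((((k + 1 : ℕ) : ℤ) - 1 : ℤ) * s) * dyadicSymbol ψ (((k + 1 : ℕ) : ℤ) - 1) ξ) ^ 2
        ≤ 4 * B ^ 2 * (if (2 : ℝ) ^ k ≤ 4 / 3 * |ξ 2| then a ^ k else 0) := by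
    have hq : (((k + 1 : ℕ) : ℤ) - 1) = (k : ℤ) := by push_cast; ring
    have hne : (k : ℤ) ≠ -1 := by omega
    have hpow : ((2 : ℝ) ^ ((k : ℝ) * s)) ^ 2 = a ^ k := by
      rw [← Real.rpow_natCast, ← Real.rpow_natCast, ← Real.rpow_mul (by norm_num),
        ← Real.rpow_mul (by norm_num), show (4 : ℝ) = 2 ^ (2 : ℝ) by norm_num,
        ← Real.rpow_mul (by norm_num)]
      congr 1
      push_cast
      ring
    rw [hq, dyadicSymbol, if_neg hne, zpow_natCast, Int.cast_natCast, mul_pow, hpow]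
    split_ifs with hk
    · have : |phiV ψ (|ξ 2| / 2 ^ k)| ≤ 2 * B := by
        unfold phiV
        linarith [abs_sub (ψ (|ξ 2| / 2 ^ k / 2)) (ψ (|ξ 2| / 2 ^ k)), hB (|ξ 2| / 2 ^ k / 2),
          hB (|ξ 2| / 2 ^ k)]
      have h3 := sq_le_sq' (by linarith [neg_le_of_abs_le this]) (le_of_abs_le this)
      calc a ^ k * phiV ψ (|ξ 2| / 2 ^ k) ^ 2 ≤ a ^ k * (2 * B) ^ 2 := by gcongr
        _ = 4 * B ^ 2 * a ^ k := by ring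
    · have : phiV ψ (|ξ 2| / 2 ^ k) = 0 := by
        by_contra h
        refine hk ?_
        have := hψ.three_quarters_le_of_phiV_ne_zero (by positivity) h
        rw [le_div_iff₀ (by positivity)] at this
        linarith
      simp [this]
  have hw := one_le_vWeight hs.le ξ
  have hgeom : a / (a - 1) * ((4 / 3 * |ξ 2|) ^ 2) ^ s ≤
      a / (a - 1) * (16 / 9) ^ s * vWeight s ξ := by
    rw [mul_assoc, vWeight, ← Real.mul_rpow (by positivity) (by positivity), mul_pow, sq_abs]
    gcongr
    · norm_num
    · linarith
  have hB1 : B ^ 2 + 1 ≤ (B ^ 2 + 1) * vWeight s ξ := le_mul_of_one_le_right (by positivity) hw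
  cases N with
  | zero =>
    have := vWeight_pos s ξ
    simp only [Finset.range_zero, Finset.sum_empty]
    positivity
  | succ N =>
    rw [Finset.sum_range_succ']
    calc _ ≤ ∑ k ∈ Finset.range N,
          4 * B ^ 2 * (if (2 : ℝ) ^ k ≤ 4 / 3 * |ξ 2| then a ^ k else 0) + (B ^ 2 + 1) :=
          add_le_add (Finset.sum_le_sum fun k _ => hhigh k) hlow
      _ ≤ 4 * B ^ 2 * (a / (a - 1) * (16 / 9) ^ s * vWeight s ξ) + (B ^ 2 + 1) * vWeight s ξ := by
          rw [← Finset.mul_sum]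
          gcongr
          exact (sum_range_ite_geom_le hs N).trans hgeom
      _ = _ := by ring

theorem exists_square_summable_weights {a : ℤ → ℝ} (ha : ∀ q, 0 ≤ a q) {D : ℝ} (hD : 0 ≤ D)
    (hsum : ∀ N : ℕ, ∑ n ∈ Finset.range N, a ((n : ℤ) - 1) ^ 2 ≤ D ^ 2) :
    ∃ c : ℤ → ℝ, (∀ q, 0 ≤ c q) ∧ Summable (fun n : ℕ => c ((n : ℤ) - 1) ^ 2) ∧
      ∑' n : ℕ, c ((n : ℤ) - 1) ^ 2 ≤ 1 ∧ ∀ q : ℤ, -1 ≤ q → a q ≤ D * c q := by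
  have hpart (N : ℕ) : ∑ n ∈ Finset.range N, (a ((n : ℤ) - 1) / D) ^ 2 ≤ 1 := by
    simp_rw [div_pow, ← Finset.sum_div]
    exact div_le_one_of_le₀ (hsum N) (by positivity)
  refine ⟨fun q => a q / D, fun q => div_nonneg (ha q) hD,
    summable_of_sum_range_le (fun n => sq_nonneg _) hpart,
    Real.tsum_le_of_sum_range_le (fun n => sq_nonneg _) hpart, fun q hq => ?_⟩
  rcases hD.eq_or_lt with rfl | hpos
  · obtain ⟨n, rfl⟩ : ∃ n : ℕ, q = (n : ℤ) - 1 := ⟨(q + 1).toNat, by omega⟩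
    have h := hsum (n + 1)
    have hn := Finset.single_le_sum (f := fun n : ℕ => a ((n : ℤ) - 1) ^ 2)
      (fun i _ => sq_nonneg _) (Finset.self_mem_range_succ n)
    simp only [zero_mul]
    nlinarith [ha ((n : ℤ) - 1)]
  · rw [mul_div_cancel₀ _ hpos.ne']


/-- Complexification of a real-valued Schwartz function. -/
def complexify (f : 𝓢(E3, ℝ)) : 𝓢(E3, ℂ) := f.postcompCLM Complex.ofRealCLM

theorem complexify_apply (f : 𝓢(E3, ℝ)) (x : E3) : complexify f x = (f x : ℂ) := rfl

theorem fourier_complexify (f : 𝓢(E3, ℝ)) (ξ : E3) :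
    𝓕 (complexify f) ξ = 𝓕 (toC fun x => f x) ξ := rfl

theorem lineDeriv_complexify (f : 𝓢(E3, ℝ)) (j : Fin 3) (x : E3) :
    (∂_{EuclideanSpace.single j (1 : ℝ)} (complexify f)) x = (pd j (fun x => f x) x : ℂ) := by
  rw [SchwartzMap.lineDerivOp_apply_eq_fderiv]
  have h : HasFDerivAt (complexify f) (Complex.ofRealCLM.comp (fderiv ℝ f x)) x :=
    Complex.ofRealCLM.hasFDerivAt.comp x (f.hasFDerivAt x)
  rw [h.fderiv]
  rfl

/-- The term `u^j ∂_j g` as a complex-valued Schwartz function. -/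
def convTerm (u : Fin 3 → 𝓢(E3, ℝ)) (g : 𝓢(E3, ℝ)) (j : Fin 3) : 𝓢(E3, ℂ) :=
  SchwartzMap.pairing (ContinuousLinearMap.mul ℂ ℂ) (complexify (u j))
    (∂_{EuclideanSpace.single j (1 : ℝ)} (complexify g))

/-- The scalar convection term `u·∇g` as a complex-valued Schwartz function. -/
def convSchwartz (u : Fin 3 → 𝓢(E3, ℝ)) (g : 𝓢(E3, ℝ)) : 𝓢(E3, ℂ) :=
  ∑ j, convTerm u g j

theorem convSchwartz_apply (u v : Fin 3 → 𝓢(E3, ℝ)) (i : Fin 3) (x : E3) :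
    convSchwartz u (v i) x = (convT (fun i x => u i x) (fun i x => v i x) i x : ℂ) := by
  simp [convSchwartz, convTerm, convT, complexify_apply, lineDeriv_complexify]

/-- The square of the norm `H^{0,s}` of a Schwartz function. -/
def vEnergy (s : ℝ) (f : 𝓢(E3, ℂ)) : ℝ := ∫ ξ, vWeight s ξ * ‖𝓕 f ξ‖ ^ 2

theorem vEnergy_nonneg (s : ℝ) (f : 𝓢(E3, ℂ)) : 0 ≤ vEnergy s f :=
  integral_vWeight_nonneg s (𝓕 f)

theorem rpow_half_sq {x : ℝ} (hx : 0 ≤ x) : (x ^ (1 / 2 : ℝ)) ^ 2 = x := by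
  rw [← Real.sqrt_eq_rpow, Real.sq_sqrt hx]

theorem anisoNorm_zero_sq (s : ℝ) (f : 𝓢(E3, ℝ)) :
    anisoNorm 0 s (toC fun x => f x) ^ 2 = vEnergy s (complexify f) := by
  rw [anisoNorm, rpow_half_sq]
  · simp [vEnergy, vWeight, fourier_complexify]
  · exact integral_nonneg fun ξ => by positivity

theorem anisoNormF_zero_sq (s : ℝ) (u : Fin 3 → 𝓢(E3, ℝ)) :
    anisoNormF 0 s (fun i x => u i x) ^ 2 = ∑ i, vEnergy s (complexify (u i)) := by
  rw [anisoNormF, rpow_half_sq (Finset.sum_nonneg fun i _ => sq_nonneg _)]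
  exact Finset.sum_congr rfl fun i _ => anisoNorm_zero_sq s (u i)

theorem vEnergy_sum_le (s : ℝ) (F : Fin 3 → 𝓢(E3, ℂ)) :
    vEnergy s (∑ j, F j) ≤ 3 * ∑ j, vEnergy s (F j) := by
  unfold vEnergy
  rw [← integral_finsetSum _ fun j _ => integrable_vWeight_mul_sq s (𝓕 (F j)),
    ← integral_const_mul]
  refine integral_mono (integrable_vWeight_mul_sq s (𝓕 (∑ j, F j)))
    ((integrable_finsetSum _ fun j _ => integrable_vWeight_mul_sq s (𝓕 (F j))).const_mul 3)
    fun ξ => ?_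
  have hsum : 𝓕 (∑ j, F j) ξ = ∑ j, 𝓕 (F j) ξ := by
    have : 𝓕 (∑ j, F j) = ∑ j, 𝓕 (F j) :=
      map_sum (FourierTransform.fourierCLM ℂ 𝓢(E3, ℂ)) F Finset.univ
    rw [this, sum_apply]
  have hnorm : ‖𝓕 (∑ j, F j) ξ‖ ^ 2 ≤ 3 * ∑ j, ‖𝓕 (F j) ξ‖ ^ 2 := by
    rw [hsum]
    calc ‖∑ j, 𝓕 (F j) ξ‖ ^ 2 ≤ (∑ j, ‖𝓕 (F j) ξ‖) ^ 2 := by gcongr; exact norm_sum_le _ _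
      _ ≤ _ := by
        simpa using sq_sum_le_card_mul_sum_sq (s := Finset.univ) (f := fun j => ‖𝓕 (F j) ξ‖)
  calc vWeight s ξ * ‖𝓕 (∑ j, F j) ξ‖ ^ 2
      ≤ vWeight s ξ * (3 * ∑ j, ‖𝓕 (F j) ξ‖ ^ 2) :=
        mul_le_mul_of_nonneg_left hnorm (vWeight_pos s ξ).le
    _ = 3 * ∑ j, vWeight s ξ * ‖𝓕 (F j) ξ‖ ^ 2 := by rw [← Finset.mul_sum]; ring

theorem exists_sum_vEnergy_convSchwartz_le {s : ℝ} (hs : 0 ≤ s) {R : ℝ} :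
    ∃ K ≥ 0, ∀ u v : Fin 3 → 𝓢(E3, ℝ),
      (∀ i ξ, 𝓕 (complexify (v i)) ξ ≠ 0 → ‖ξ‖ ≤ R) →
      ∑ i, vEnergy s (convSchwartz u (v i)) ≤
        K * (∑ j, vEnergy s (complexify (u j))) * ∑ i, vEnergy s (complexify (v i)) := by
  set A := (2 * (1 + R ^ 2)) ^ s * volume.real (Metric.closedBall (0 : E3) R) * (2 * π * R) ^ 2
  refine ⟨3 * A, by positivity, fun u v hv => ?_⟩
  rw [Finset.mul_sum]
  refine Finset.sum_le_sum fun i _ => (vEnergy_sum_le s _).trans ?_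
  calc 3 * ∑ j, vEnergy s (convTerm u (v i) j)
      ≤ 3 * ∑ j, A * vEnergy s (complexify (u j)) * vEnergy s (complexify (v i)) := by
        gcongr with j
        exact integral_vWeight_fourier_mul_lineDeriv_le hs (complexify (u j)) (complexify (v i))
          _ j (fun x => rfl) (hv i)
    _ = _ := by
        rw [← Finset.sum_mul, ← Finset.mul_sum]
        ring

theorem integrable_dyadicSymbol_mul_sq {ψ : ℝ → ℝ} (hψ : VCutoff ψ) (q : ℤ) (f : 𝓢(E3, ℂ)) :
    Integrable fun ξ => dyadicSymbol ψ q ξ ^ 2 * ‖f ξ‖ ^ 2 := by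
  have h := (SchwartzMap.smulLeftCLM ℂ (dyadicSymbol ψ q) f).memLp 2
  refine (h.integrable_norm_pow two_ne_zero).congr (ae_of_all _ fun ξ => ?_)
  simp only [SchwartzMap.smulLeftCLM_apply_apply (hψ.hasTemperateGrowth_dyadicSymbol q), norm_smul,
    mul_pow, Real.norm_eq_abs, sq_abs]

theorem l2NormF_deltaVF_sq {ψ : ℝ → ℝ} (hψ : VCutoff ψ) (q : ℤ) (F : Fin 3 → 𝓢(E3, ℂ)) :
    l2NormF (deltaVF ψ q fun i x => F i x) ^ 2 =
      ∑ i, ∫ ξ, dyadicSymbol ψ q ξ ^ 2 * ‖𝓕 (F i) ξ‖ ^ 2 := by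
  rw [l2NormF, rpow_half_sq (integral_nonneg fun x => Finset.sum_nonneg fun i _ => sq_nonneg _)]
  set G : Fin 3 → 𝓢(E3, ℂ) :=
    fun i => SchwartzMap.smulLeftCLM ℂ (dyadicSymbol ψ q) (𝓕 (F i))
  have hGapp (i : Fin 3) (ξ : E3) : G i ξ = dyadicSymbol ψ q ξ • 𝓕 (F i) ξ :=
    SchwartzMap.smulLeftCLM_apply_apply (hψ.hasTemperateGrowth_dyadicSymbol q) _ _
  have hdelta (i : Fin 3) : deltaVF ψ q (fun i x => F i x) i = 𝓕⁻ (G i) := by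
    rw [SchwartzMap.fourierInv_coe]
    refine congrArg (fun g : E3 → ℂ => 𝓕⁻ g) (funext fun ξ => ?_)
    rw [hGapp, Complex.real_smul]
    rfl
  simp_rw [hdelta]
  rw [integral_finsetSum _ fun i _ => ((𝓕⁻ (G i)).memLp 2).integrable_norm_pow two_ne_zero]
  refine Finset.sum_congr rfl fun i _ => ?_
  rw [← SchwartzMap.integral_norm_sq_fourier, FourierTransform.fourier_fourierInv_eq]
  refine integral_congr_ae (ae_of_all _ fun ξ => ?_)
  simp only [hGapp, norm_smul, mul_pow, Real.norm_eq_abs, sq_abs]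

theorem VCutoff.exists_sum_deltaVF_sq_le {ψ : ℝ → ℝ} (hψ : VCutoff ψ) {s : ℝ} (hs : 0 < s) :
    ∃ K > 0, ∀ (F : Fin 3 → 𝓢(E3, ℂ)) (N : ℕ), ∑ n ∈ Finset.range N,
      ((2 : ℝ) ^ ((((n : ℤ) - 1 : ℤ) : ℝ) * s) *
        l2NormF (deltaVF ψ ((n : ℤ) - 1) fun i x => F i x)) ^ 2 ≤ K * ∑ i, vEnergy s (F i) := by
  obtain ⟨K, hK, hsum⟩ := hψ.exists_sum_dyadicSymbol_sq_le hs
  refine ⟨K, hK, fun F N => ?_⟩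
  simp_rw [mul_pow, l2NormF_deltaVF_sq hψ, Finset.mul_sum]
  rw [Finset.sum_comm]
  refine Finset.sum_le_sum fun i _ => ?_
  simp_rw [← integral_const_mul]
  rw [← integral_finsetSum _ fun n _ => (integrable_dyadicSymbol_mul_sq hψ _ _).const_mul _,
    vEnergy, ← integral_const_mul]
  refine integral_mono
    (integrable_finsetSum _ fun n _ => (integrable_dyadicSymbol_mul_sq hψ _ _).const_mul _)
    ((integrable_vWeight_mul_sq s (𝓕 (F i))).const_mul K) fun ξ => ?_
  simp_rw [← mul_assoc, ← Finset.sum_mul, ← mul_pow]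
  gcongr
  exact hsum N ξ

theorem energy_estimate_frequency_localized
    (ψ : ℝ → ℝ) (hψ : VCutoff ψ) (s : ℝ) (hs : 1/2 < s) (R : ℝ) (hR : 0 < R) :
    ∃ C > (0:ℝ), ∀ u v : Fin 3 → SchwartzMap E3 ℝ,
      DivFree (fun i x => u i x) → DivFree (fun i x => v i x) →
      (∀ i : Fin 3, ∀ ξ : E3, 𝓕 (fun x => ((v i x : ℝ) : ℂ)) ξ ≠ 0 → ‖ξ‖ ≤ R) →
      ∃ c : ℤ → ℝ, (∀ q, 0 ≤ c q) ∧ Summable (fun n : ℕ => (c ((n:ℤ) - 1))^2) ∧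
        (∑' n : ℕ, (c ((n:ℤ) - 1))^2) ≤ 1 ∧
        ∀ q : ℤ, -1 ≤ q →
          l2NormF (deltaVF ψ q (fun i x => (convT (fun i x => u i x) (fun i x => v i x) i x : ℂ))) ≤
            C * c q * (2:ℝ) ^ (-(q:ℝ) * s) *
              anisoNormF 0 s (fun i x => u i x) * anisoNormF 0 s (fun i x => v i x) := by
  have hs0 : 0 < s := by linarith
  obtain ⟨K₁, hK₁, hdyadic⟩ := hψ.exists_sum_deltaVF_sq_le hs0
  obtain ⟨K₂, hK₂, hconv⟩ := exists_sum_vEnergy_convSchwartz_le (R := R) hs0.le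
  set C := √(K₁ * (K₂ + 1))
  have hC : 0 < C := Real.sqrt_pos.2 (by positivity)
  have hC2 : C ^ 2 = K₁ * (K₂ + 1) := Real.sq_sqrt (by positivity)
  refine ⟨C, hC, fun u v _ _ hv => ?_⟩
  have hnonneg (w : Fin 3 → 𝓢(E3, ℝ)) : 0 ≤ anisoNormF 0 s (fun i x => w i x) :=
    Real.rpow_nonneg (Finset.sum_nonneg fun i _ => sq_nonneg _) _
  set Nu := anisoNormF 0 s (fun i x => u i x)
  set Nv := anisoNormF 0 s (fun i x => v i x)
  set f : Fin 3 → E3 → ℂ :=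
    fun i x => (convT (fun i x => u i x) (fun i x => v i x) i x : ℂ)
  have hf : (fun i x => convSchwartz u (v i) x) = f :=
    funext fun i => funext fun x => convSchwartz_apply u v i x
  have hsum (N : ℕ) : ∑ n ∈ Finset.range N, ((2 : ℝ) ^ ((((n : ℤ) - 1 : ℤ) : ℝ) * s) *
      l2NormF (deltaVF ψ ((n : ℤ) - 1) f)) ^ 2 ≤ (C * Nu * Nv) ^ 2 := by
    have h := hdyadic (fun i => convSchwartz u (v i)) N
    rw [hf] at h
    refine h.trans ?_
    have h2 := hconv u v hv
    rw [← anisoNormF_zero_sq, ← anisoNormF_zero_sq] at h2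
    calc _ ≤ K₁ * (K₂ * Nu ^ 2 * Nv ^ 2) := by gcongr
      _ ≤ K₁ * ((K₂ + 1) * Nu ^ 2 * Nv ^ 2) := by gcongr; linarith
      _ = _ := by rw [mul_pow, mul_pow, hC2]; ring
  obtain ⟨c, hc0, hcs, hc1, hc⟩ := exists_square_summable_weights
    (a := fun q : ℤ => (2 : ℝ) ^ ((q : ℝ) * s) * l2NormF (deltaVF ψ q f))
    (fun q => mul_nonneg (by positivity) (Real.rpow_nonneg
      (integral_nonneg fun x => Finset.sum_nonneg fun i _ => sq_nonneg _) _))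
    (mul_nonneg (mul_nonneg hC.le (hnonneg u)) (hnonneg v)) hsum
  refine ⟨c, hc0, hcs, hc1, fun q hq => ?_⟩
  have hpow : (2 : ℝ) ^ (-(q : ℝ) * s) * (2 : ℝ) ^ ((q : ℝ) * s) = 1 := by
    rw [← Real.rpow_add (by norm_num)]
    simp
  calc l2NormF (deltaVF ψ q f)
      = (2 : ℝ) ^ (-(q : ℝ) * s) * ((2 : ℝ) ^ ((q : ℝ) * s) * l2NormF (deltaVF ψ q f)) := by
        rw [← mul_assoc, hpow, one_mul]
    _ ≤ (2 : ℝ) ^ (-(q : ℝ) * s) * (C * Nu * Nv * c q) := by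
        exact mul_le_mul_of_nonneg_left (hc q hq) (by positivity)
    _ = _ := by ring
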